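/- Let n ≥ 6 with n ≡ 1 (mod 5) or n ≡ 2 (mod 5). Then for every f ∈ ℤ/nℤ, deleting the single vertex u_f from P(n,2) decreases the domination number: γ(P(n,2) − u_f) = γ(P(n,2)) − 1; consequently the domination alteration number μ(P(n,2)) equals 1. -/

import Mathlib

namespace PetersenDom

/-- Vertex set of the generalized Petersen graph: `Sum.inl i` is the outer
vertex `u_i`, `Sum.inr i` is the inner vertex `v_i`, indices in `ZMod n`. -/
abbrev PVert (n : ℕ) := ZMod n ⊕ ZMod n

/-- The outer vertex `u_i`. -/
def uV {n : ℕ} (i : ZMod n) : PVert n := Sum.inl i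

/-- The inner vertex `v_i`. -/
def vV {n : ℕ} (i : ZMod n) : PVert n := Sum.inr i

/-- The generalized Petersen graph `P(n,2)`, with edges
`u_i u_{i+1}`, `u_i v_i`, `v_i v_{i+2}` (indices mod `n`). -/
def P2 (n : ℕ) : SimpleGraph (PVert n) :=
  SimpleGraph.fromRel (fun a b =>
    (∃ i : ZMod n, a = uV i ∧ b = uV (i + 1)) ∨
    (∃ i : ZMod n, a = uV i ∧ b = vV i) ∨
    (∃ i : ZMod n, a = vV i ∧ b = vV (i + 2)))

/-- `S` is a dominating set of `G`: every vertex is in `S` or adjacent to a vertex of `S`. -/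
def IsDomSet {V : Type*} (G : SimpleGraph V) (S : Set V) : Prop :=
  ∀ v : V, v ∈ S ∨ ∃ u ∈ S, G.Adj u v

/-- The domination number of `G`. -/
noncomputable def domNum {V : Type*} (G : SimpleGraph V) : ℕ :=
  sInf {k | ∃ S : Set V, IsDomSet G S ∧ S.ncard = k}

/-- `S` is a dominating set of `P_f(n,2) = P(n,2) - u_f`: it avoids `u_f`
and dominates every vertex other than `u_f`. -/
def IsDomSetF (n : ℕ) (f : ZMod n) (S : Set (PVert n)) : Prop :=
  uV f ∉ S ∧ ∀ v : PVert n, v ≠ uV f → v ∈ S ∨ ∃ u ∈ S, (P2 n).Adj u v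

/-- The domination number of `P_f(n,2)`. -/
noncomputable def domNumF (n : ℕ) (f : ZMod n) : ℕ :=
  sInf {k | ∃ S : Set (PVert n), IsDomSetF n f S ∧ S.ncard = k}

/-- `S` is a minimum dominating set of `P_f(n,2)`. -/
def MinDomF (n : ℕ) (f : ZMod n) (S : Set (PVert n)) : Prop :=
  IsDomSetF n f S ∧ S.ncard = domNumF n f

/-- The neighborhood `N(u_f) = {u_{f-1}, u_{f+1}, v_f}` of `u_f` in `P(n,2)`. -/
def Nbr (n : ℕ) (f : ZMod n) : Set (PVert n) := {uV (f - 1), uV (f + 1), vV f}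

/-- The block `B_i`: the 5 consecutive pairs of vertices centered at `u_i, v_i`. -/
def Blk (n : ℕ) (i : ZMod n) : Set (PVert n) :=
  {uV (i-2), uV (i-1), uV i, uV (i+1), uV (i+2),
   vV (i-2), vV (i-1), vV i, vV (i+1), vV (i+2)}

/-- `γ_i(S) = |B_i ∩ S|`. -/
noncomputable def gam (n : ℕ) (i : ZMod n) (S : Set (PVert n)) : ℕ :=
  (Blk n i ∩ S).ncard

/-- `L_i = {v_{i-1}, u_{i-2}, v_{i-2}}`. -/
def Lset (n : ℕ) (i : ZMod n) : Set (PVert n) := {vV (i-1), uV (i-2), vV (i-2)}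

/-- `R_i = {v_{i+1}, u_{i+2}, v_{i+2}}`. -/
def Rset (n : ℕ) (i : ZMod n) : Set (PVert n) := {vV (i+1), uV (i+2), vV (i+2)}

/-- `M_i = {u_{i-1}, v_i, u_{i+1}}`. -/
def Mset (n : ℕ) (i : ZMod n) : Set (PVert n) := {uV (i-1), vV i, uV (i+1)}

/-- `F = {f-2, f-1, f, f+1, f+2}`, the indices of the block `B_f`. -/
def Fset (n : ℕ) (f : ZMod n) : Set (ZMod n) := {f-2, f-1, f, f+1, f+2}

/-- A Type I set: a minimum dominating set `S` of `P_f(n,2)` with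
`γ_i(S) ≥ 2` for all `i`. -/
def TypeI (n : ℕ) (f : ZMod n) (S : Set (PVert n)) : Prop :=
  MinDomF n f S ∧ ∀ i : ZMod n, 2 ≤ gam n i S

/-- The couple number of `S`: the number of indices `i ∉ F` with `γ_i(S) = 2`. -/
noncomputable def coupleNum (n : ℕ) (f : ZMod n) (S : Set (PVert n)) : ℕ :=
  {i : ZMod n | gam n i S = 2 ∧ i ∉ Fset n f}.ncard

/-- A Type II set: a Type I set with `N(u_f) ∩ S = ∅`, `γ_f(S) = 3`, and
`B_f ∩ S = {u_{f-2}, v_{f+1}, v_{f+2}}`. -/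
def TypeII (n : ℕ) (f : ZMod n) (S : Set (PVert n)) : Prop :=
  TypeI n f S ∧ Nbr n f ∩ S = ∅ ∧ gam n f S = 3 ∧
    Blk n f ∩ S = {uV (f-2), vV (f+1), vV (f+2)}

/-- A Type III set: a Type I set with `N(u_f) ∩ S = ∅`, `γ_f(S) = 4`, and
`B_f ∩ S` one of four specified patterns. -/
def TypeIII (n : ℕ) (f : ZMod n) (S : Set (PVert n)) : Prop :=
  TypeI n f S ∧ Nbr n f ∩ S = ∅ ∧ gam n f S = 4 ∧
    (Blk n f ∩ S = {vV (f-1), vV (f+1), uV (f+2), vV (f+2)} ∨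
     Blk n f ∩ S = {uV (f-2), vV (f-2), uV (f+2), vV (f+2)} ∨
     Blk n f ∩ S = {vV (f-2), vV (f-1), vV (f+1), vV (f+2)} ∨
     Blk n f ∩ S = {uV (f-2), vV (f-2), vV (f+1), uV (f+2)})

/-- `⌈3n/5⌉`. -/
noncomputable def ceil35 (n : ℕ) : ℕ := ⌈(3 * (n : ℚ)) / 5⌉₊

/-- The bondage number of `G`: the least number of edges whose deletion
increases the domination number. -/
noncomputable def bondage {V : Type*} (G : SimpleGraph V) : ℕ :=
  sInf {k | ∃ E : Set (Sym2 V), E ⊆ G.edgeSet ∧ E.ncard = k ∧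
    domNum G < domNum (G.deleteEdges E)}

/-- The domination alteration number of `G`: the least number of vertices
whose removal changes the domination number. -/
noncomputable def alterNum {V : Type*} (G : SimpleGraph V) : ℕ :=
  sInf {k | ∃ A : Set V, A.ncard = k ∧ domNum (G.induce Aᶜ) ≠ domNum G}

end PetersenDom
namespace PetersenDom

/-- The closed neighbourhood of an outer vertex. -/
lemma mem_or_adj_uV {n : ℕ} (S : Set (PVert n)) (i : ZMod n) :
    (uV i ∈ S ∨ ∃ w ∈ S, (P2 n).Adj w (uV i)) ↔
      uV i ∈ S ∨ vV i ∈ S ∨ uV (i - 1) ∈ S ∨ uV (i + 1) ∈ S := by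
  constructor
  · rintro (h | ⟨w, hw, -, h⟩)
    · exact Or.inl h
    · rcases h with (⟨j, rfl, h⟩ | ⟨j, rfl, h⟩ | ⟨j, rfl, h⟩) |
        (⟨j, h, rfl⟩ | ⟨j, h, rfl⟩ | ⟨j, h, rfl⟩) <;>
        simp only [uV, vV, Sum.inl.injEq, reduceCtorEq] at h <;> subst h <;> simp_all [uV, vV]
  · by_cases h0 : uV i ∈ S
    · exact fun _ => Or.inl h0
    rintro (h | h | h | h)
    · exact Or.inl h
    · exact Or.inr ⟨_, h, by simp [uV, vV], Or.inr (Or.inr (Or.inl ⟨i, rfl, rfl⟩))⟩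
    · refine Or.inr ⟨_, h, fun e => h0 (e ▸ h), Or.inl (Or.inl ⟨i - 1, rfl, by simp⟩)⟩
    · exact Or.inr ⟨_, h, fun e => h0 (e ▸ h), Or.inr (Or.inl ⟨i, rfl, rfl⟩)⟩

/-- The closed neighbourhood of an inner vertex. -/
lemma mem_or_adj_vV {n : ℕ} (S : Set (PVert n)) (i : ZMod n) :
    (vV i ∈ S ∨ ∃ w ∈ S, (P2 n).Adj w (vV i)) ↔
      vV i ∈ S ∨ uV i ∈ S ∨ vV (i - 2) ∈ S ∨ vV (i + 2) ∈ S := by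
  constructor
  · rintro (h | ⟨w, hw, -, h⟩)
    · exact Or.inl h
    · rcases h with (⟨j, rfl, h⟩ | ⟨j, rfl, h⟩ | ⟨j, rfl, h⟩) |
        (⟨j, h, rfl⟩ | ⟨j, h, rfl⟩ | ⟨j, h, rfl⟩) <;>
        simp only [uV, vV, Sum.inr.injEq, reduceCtorEq] at h <;> subst h <;> simp_all [uV, vV]
  · by_cases h0 : vV i ∈ S
    · exact fun _ => Or.inl h0
    rintro (h | h | h | h)
    · exact Or.inl h
    · exact Or.inr ⟨_, h, by simp [uV, vV], Or.inl (Or.inr (Or.inl ⟨i, rfl, rfl⟩))⟩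
    · refine Or.inr ⟨_, h, fun e => h0 (e ▸ h), Or.inl (Or.inr (Or.inr ⟨i - 2, rfl, by simp⟩))⟩
    · exact Or.inr ⟨_, h, fun e => h0 (e ▸ h), Or.inr (Or.inr (Or.inr ⟨i, rfl, rfl⟩))⟩

/-- A potential on local states. The arguments record whether the set contains `u_i`, `v_i` and
`v_{i-1}`, and whether `u_i`, `v_i` and `v_{i-1}` are dominated from the columns up to the
`i`-th one. -/
def potential : Bool → Bool → Bool → Bool → Bool → Bool → ℕ
  | false, false, false, false, true, true => 4
  | false, false, false, false, _, z => if z then 1 else 0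
  | false, false, false, true, true, true => 4
  | false, false, false, true, _, _ => 3
  | false, false, true, false, y, _ => if y then 4 else 1
  | false, false, true, true, y, _ => if y then 7 else 3
  | false, true, p, _, _, _ => if p then 7 else 5
  | true, false, true, _, _, _ => 7
  | true, false, false, _, _, z => if z then 6 else 3
  | true, true, true, _, _, _ => 10
  | true, true, false, _, _, z => if z then 6 else 5

/-- The potential of the state at the last of four consecutive columns, with outer entries
`_`, `_`, `u₂`, `u₃` and inner entries `v₀`, `v₁`, `v₂`, `v₃`. -/
def windowPotential (v₀ v₁ u₂ v₂ u₃ v₃ : Bool) : ℕ :=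
  potential u₃ v₃ v₂ (u₃ || v₃ || u₂) (u₃ || v₃ || v₁) (u₂ || v₂ || v₀)

lemma windowPotential_step : ∀ v₀ v₁ u₂ v₂ u₃ v₃ u₄ v₄ : Bool,
    (u₃ || v₃ || u₂ || u₄) = true → (v₂ || u₂ || v₀ || v₄) = true →
      windowPotential v₁ v₂ u₃ v₃ u₄ v₄ + 3 ≤
        5 * (u₄.toNat + v₄.toNat) + windowPotential v₀ v₁ u₂ v₂ u₃ v₃ := by
  decide

open Classical in
lemma ncard_eq_sum {n : ℕ} [NeZero n] (S : Set (PVert n)) :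
    S.ncard = ∑ i : ZMod n, ((decide (uV i ∈ S)).toNat + (decide (vV i ∈ S)).toNat) := by
  rw [Set.ncard_eq_toFinset_card', Finset.sum_add_distrib]
  have h : S.toFinset = Finset.univ.filter (· ∈ S) := by ext; simp
  rw [h, Finset.card_filter, Fintype.sum_sum_type]
  congr 1 <;> refine Finset.sum_congr rfl fun i _ => ?_
  · by_cases hi : uV i ∈ S
    · simp only [hi, decide_true, Bool.toNat_true]; exact if_pos hi
    · simp only [hi, decide_false, Bool.toNat_false]; exact if_neg hi
  · by_cases hi : vV i ∈ S
    · simp only [hi, decide_true, Bool.toNat_true]; exact if_pos hi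
    · simp only [hi, decide_false, Bool.toNat_false]; exact if_neg hi

open Classical in
lemma three_mul_le_five_mul_ncard {n : ℕ} [NeZero n] {S : Set (PVert n)}
    (hS : IsDomSet (P2 n) S) : 3 * n ≤ 5 * S.ncard := by
  set u : ZMod n → Bool := fun i => decide (uV i ∈ S) with hu
  set v : ZMod n → Bool := fun i => decide (vV i ∈ S) with hv
  set φ : ZMod n → ℕ := fun i =>
    windowPotential (v (i - 3)) (v (i - 2)) (u (i - 1)) (v (i - 1)) (u i) (v i) with hφ
  have step (i : ZMod n) :
      φ (i + 1) + 3 ≤ 5 * ((u (i + 1)).toNat + (v (i + 1)).toNat) + φ i := by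
    have h₁ := (mem_or_adj_uV S i).1 (hS _)
    have h₂ := (mem_or_adj_vV S (i - 1)).1 (hS _)
    have e₁ : i + 1 - 3 = i - 2 := by ring
    have e₂ : i + 1 - 2 = i - 1 := by ring
    have e₃ : i + 1 - 1 = i := by ring
    have e₄ : i - 1 - 2 = i - 3 := by ring
    have e₅ : i - 1 + 2 = i + 1 := by ring
    rw [e₄, e₅] at h₂
    simp only [hφ, e₁, e₂, e₃]
    apply windowPotential_step
    · simpa [hu, hv, or_assoc] using h₁
    · simpa [hu, hv, or_assoc] using h₂
  have hsum := Finset.sum_le_sum fun i (_ : i ∈ (Finset.univ : Finset (ZMod n))) => step i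
  have hshift (g : ZMod n → ℕ) : ∑ i, g (i + 1) = ∑ i, g i := Equiv.sum_comp (Equiv.addRight 1) g
  rw [Finset.sum_add_distrib, Finset.sum_add_distrib, ← Finset.mul_sum, hshift φ,
    hshift fun i => (u i).toNat + (v i).toNat, ← ncard_eq_sum S] at hsum
  simp only [Finset.sum_const, Finset.card_univ, ZMod.card, smul_eq_mul] at hsum
  omega

/-- `k` consecutive copies of the pattern `u_j, v_{j+2}, v_{j+3}` of period 5, from column `a`. -/
def periodicSet (n k : ℕ) (a : ZMod n) : Finset (PVert n) :=
  (Finset.range k).image (fun q => uV (a + (5 * q : ℕ))) ∪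
    ((Finset.range k).image (fun q => vV (a + (5 * q + 2 : ℕ))) ∪
      (Finset.range k).image (fun q => vV (a + (5 * q + 3 : ℕ))))

lemma card_periodicSet_le (n k : ℕ) (a : ZMod n) : (periodicSet n k a).card ≤ 3 * k := by
  have key (g : ℕ → PVert n) : ((Finset.range k).image g).card ≤ k := by
    simpa using Finset.card_image_le (s := Finset.range k) (f := g)
  unfold periodicSet
  have h₁ := key fun q => uV (a + (5 * q : ℕ))
  have h₂ := key fun q => vV (a + (5 * q + 2 : ℕ))
  have h₃ := key fun q => vV (a + (5 * q + 3 : ℕ))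
  grw [Finset.card_union_le, Finset.card_union_le]
  omega

lemma uV_mem_periodicSet {n k : ℕ} {a i : ZMod n} :
    uV i ∈ periodicSet n k a ↔ ∃ q < k, a + (5 * q : ℕ) = i := by
  simp [periodicSet, uV, vV]

lemma vV_mem_periodicSet {n k q : ℕ} {a i : ZMod n} (hq : q < k)
    (hi : i = a + (5 * q + 2 : ℕ) ∨ i = a + (5 * q + 3 : ℕ)) : vV i ∈ periodicSet n k a := by
  simp only [periodicSet, Finset.mem_union, Finset.mem_image, Finset.mem_range]
  rcases hi with rfl | rfl
  · exact Or.inr (Or.inl ⟨q, hq, rfl⟩)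
  · exact Or.inr (Or.inr ⟨q, hq, rfl⟩)

lemma uV_dominated {n k j : ℕ} {a : ZMod n} {S : Set (PVert n)} (hS : ↑(periodicSet n k a) ⊆ S)
    (hj : j + 1 < 5 * k) :
    uV (a + (j : ZMod n)) ∈ S ∨ ∃ w ∈ S, (P2 n).Adj w (uV (a + (j : ZMod n))) := by
  rw [mem_or_adj_uV]
  obtain ⟨q, r, hr, rfl⟩ : ∃ q r, r < 5 ∧ j = 5 * q + r := ⟨j / 5, j % 5, by omega, by omega⟩
  interval_cases r
  · exact Or.inl (hS (uV_mem_periodicSet.2 ⟨q, by omega, rfl⟩))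
  · exact Or.inr (Or.inr (Or.inl (hS (uV_mem_periodicSet.2
      ⟨q, by omega, by push_cast; ring⟩))))
  · exact Or.inr (Or.inl (hS (vV_mem_periodicSet (q := q) (by omega) (Or.inl rfl))))
  · exact Or.inr (Or.inl (hS (vV_mem_periodicSet (q := q) (by omega) (Or.inr rfl))))
  · exact Or.inr (Or.inr (Or.inr (hS (uV_mem_periodicSet.2
      ⟨q + 1, by omega, by push_cast; ring⟩))))

lemma vV_dominated {n k j : ℕ} {a : ZMod n} {S : Set (PVert n)} (hS : ↑(periodicSet n k a) ⊆ S)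
    (hk : 0 < k) (hj : j ≤ 5 * k) :
    vV (a + (j : ZMod n)) ∈ S ∨ ∃ w ∈ S, (P2 n).Adj w (vV (a + (j : ZMod n))) := by
  rw [mem_or_adj_vV]
  rcases hj.eq_or_lt with rfl | hj
  · obtain ⟨m, rfl⟩ : ∃ m, k = m + 1 := ⟨k - 1, by omega⟩
    exact Or.inr (Or.inr (Or.inl (hS (vV_mem_periodicSet (q := m) (by omega)
      (Or.inr (by push_cast; ring))))))
  obtain ⟨q, r, hr, rfl⟩ : ∃ q r, r < 5 ∧ j = 5 * q + r := ⟨j / 5, j % 5, by omega, by omega⟩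
  interval_cases r
  · exact Or.inr (Or.inl (hS (uV_mem_periodicSet.2 ⟨q, by omega, rfl⟩)))
  · exact Or.inr (Or.inr (Or.inr (hS (vV_mem_periodicSet (q := q) (by omega)
      (Or.inr (by push_cast; ring))))))
  · exact Or.inl (hS (vV_mem_periodicSet (q := q) (by omega) (Or.inl rfl)))
  · exact Or.inl (hS (vV_mem_periodicSet (q := q) (by omega) (Or.inr rfl)))
  · exact Or.inr (Or.inr (Or.inl (hS (vV_mem_periodicSet (q := q) (by omega)
      (Or.inl (by push_cast; ring))))))

lemma exists_eq_add_natCast {n : ℕ} [NeZero n] (a x : ZMod n) : ∃ j < n, x = a + (j : ZMod n) :=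
  ⟨(x - a).val, ZMod.val_lt _, by simp⟩

lemma natCast_ne_zero_of_lt {n m : ℕ} (h₀ : 0 < m) (h : m < n) : (m : ZMod n) ≠ 0 := by
  rw [Ne, ZMod.natCast_eq_zero_iff]
  exact fun hd => absurd (Nat.le_of_dvd h₀ hd) (by omega)

lemma exists_isDomSetF_of_mod_one {k : ℕ} (hk : 0 < k) (f : ZMod (5 * k + 1)) :
    ∃ S, IsDomSetF (5 * k + 1) f S ∧ S.ncard ≤ 3 * k := by
  have hn : (5 * k + 1 : ZMod (5 * k + 1)) = 0 := by
    exact_mod_cast ZMod.natCast_self (5 * k + 1)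
  refine ⟨periodicSet _ k (f + 2), ⟨?_, ?_⟩, ?_⟩
  · rw [Finset.mem_coe, uV_mem_periodicSet]
    rintro ⟨q, hq, h⟩
    refine natCast_ne_zero_of_lt (n := 5 * k + 1) (m := 5 * q + 2) (by omega) (by omega) ?_
    push_cast at h ⊢
    linear_combination h
  · rintro (x | x) hx
    · obtain ⟨j, hj, rfl⟩ := exists_eq_add_natCast (f + 2) x
      rcases lt_trichotomy (j + 1) (5 * k) with h | h | h
      · exact uV_dominated subset_rfl h
      · refine absurd (congrArg uV ?_) hx
        have h' : (j + 1 : ZMod (5 * k + 1)) = 5 * k := by exact_mod_cast congrArg _ h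
        linear_combination h' + hn
      · obtain rfl : j = 5 * k := by omega
        refine (mem_or_adj_uV _ _).2 (Or.inr (Or.inr (Or.inr ?_)))
        rw [Finset.mem_coe, uV_mem_periodicSet]
        refine ⟨0, hk, ?_⟩
        push_cast
        linear_combination -hn
    · obtain ⟨j, hj, rfl⟩ := exists_eq_add_natCast (f + 2) x
      exact vV_dominated subset_rfl hk (Nat.lt_succ_iff.1 hj)
  · rw [Set.ncard_coe_finset]
    exact card_periodicSet_le _ _ _

lemma exists_isDomSetF_of_mod_two {k : ℕ} (hk : 0 < k) (f : ZMod (5 * k + 2)) :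
    ∃ S, IsDomSetF (5 * k + 2) f S ∧ S.ncard ≤ 3 * k + 1 := by
  have hn : (5 * k + 2 : ZMod (5 * k + 2)) = 0 := by
    exact_mod_cast ZMod.natCast_self (5 * k + 2)
  have hlast (j : ℕ) (hj : j = 5 * k + 1) :
      f + 3 + (j : ZMod (5 * k + 2)) = f + 2 := by
    subst hj
    push_cast
    linear_combination hn
  refine ⟨insert (uV (f + 2)) ↑(periodicSet _ k (f + 3)), ⟨?_, ?_⟩, ?_⟩
  · rw [Set.mem_insert_iff, Finset.mem_coe, uV_mem_periodicSet]
    rintro (h | ⟨q, hq, h⟩)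
    · refine natCast_ne_zero_of_lt (n := 5 * k + 2) (m := 2) (by omega) (by omega) ?_
      simpa [uV] using h
    · refine natCast_ne_zero_of_lt (n := 5 * k + 2) (m := 5 * q + 3) (by omega) (by omega) ?_
      push_cast at h ⊢
      linear_combination h
  · rintro (x | x) hx
    · obtain ⟨j, hj, rfl⟩ := exists_eq_add_natCast (f + 3) x
      rcases lt_trichotomy (j + 1) (5 * k) with h | h | h
      · exact uV_dominated (Set.subset_insert _ _) h
      · refine absurd (congrArg uV ?_) hx
        have h' : (j + 1 : ZMod (5 * k + 2)) = 5 * k := by exact_mod_cast congrArg _ h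
        linear_combination h' + hn
      · refine (mem_or_adj_uV _ _).2 ?_
        obtain rfl | h : j = 5 * k ∨ j = 5 * k + 1 := by omega
        · refine Or.inr (Or.inr (Or.inr (Or.inl (congrArg uV ?_))))
          push_cast
          linear_combination hn
        · exact Or.inl (Or.inl (congrArg uV (hlast j h)))
    · obtain ⟨j, hj, rfl⟩ := exists_eq_add_natCast (f + 3) x
      rcases Nat.lt_succ_iff_lt_or_eq.1 hj with h | h
      · exact vV_dominated (Set.subset_insert _ _) hk (Nat.lt_succ_iff.1 h)
      · exact (mem_or_adj_vV _ _).2 (Or.inr (Or.inl (Or.inl (congrArg uV (hlast j h)))))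
  · grw [Set.ncard_insert_le, Set.ncard_coe_finset, card_periodicSet_le]

lemma exists_isDomSetF_five_mul_ncard_lt {n : ℕ} (hn : 6 ≤ n) (hmod : n % 5 = 1 ∨ n % 5 = 2)
    (f : ZMod n) : ∃ S, IsDomSetF n f S ∧ 5 * S.ncard < 3 * n := by
  rcases hmod with h | h
  · obtain ⟨k, rfl⟩ : ∃ k, n = 5 * k + 1 := ⟨n / 5, by omega⟩
    obtain ⟨S, hS, hc⟩ := exists_isDomSetF_of_mod_one (by omega) f
    exact ⟨S, hS, by omega⟩
  · obtain ⟨k, rfl⟩ : ∃ k, n = 5 * k + 2 := ⟨n / 5, by omega⟩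
    obtain ⟨S, hS, hc⟩ := exists_isDomSetF_of_mod_two (by omega) f
    exact ⟨S, hS, by omega⟩

lemma domNum_le {V : Type*} {G : SimpleGraph V} {S : Set V} (hS : IsDomSet G S) :
    domNum G ≤ S.ncard :=
  Nat.sInf_le ⟨S, hS, rfl⟩

lemma exists_ncard_eq_domNum {V : Type*} (G : SimpleGraph V) :
    ∃ S, IsDomSet G S ∧ S.ncard = domNum G :=
  Nat.sInf_mem (s := {k | ∃ S : Set V, IsDomSet G S ∧ S.ncard = k})
    ⟨_, Set.univ, fun _ => Or.inl trivial, rfl⟩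

lemma three_mul_le_five_mul_domNum (n : ℕ) [NeZero n] : 3 * n ≤ 5 * domNum (P2 n) := by
  obtain ⟨S, hS, hc⟩ := exists_ncard_eq_domNum (P2 n)
  exact hc ▸ three_mul_le_five_mul_ncard hS

lemma domNum_le_of_iso {V W : Type*} {G : SimpleGraph V} {H : SimpleGraph W} (e : G ≃g H) :
    domNum H ≤ domNum G := by
  obtain ⟨S, hS, hc⟩ := exists_ncard_eq_domNum G
  rw [← hc, ← Set.ncard_image_of_injective S e.injective]
  refine domNum_le fun w => ?_
  obtain ⟨x, rfl⟩ := e.surjective w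
  rcases hS x with h | ⟨y, hy, hyx⟩
  · exact Or.inl ⟨x, h, rfl⟩
  · exact Or.inr ⟨e y, ⟨y, hy, rfl⟩, e.map_adj_iff.2 hyx⟩

lemma domNum_eq_of_iso {V W : Type*} {G : SimpleGraph V} {H : SimpleGraph W} (e : G ≃g H) :
    domNum G = domNum H :=
  (domNum_le_of_iso e.symm).antisymm (domNum_le_of_iso e)

lemma domNum_induce_compl_singleton_le {n : ℕ} {f : ZMod n} {S : Set (PVert n)}
    (hS : IsDomSetF n f S) : domNum ((P2 n).induce {uV f}ᶜ) ≤ S.ncard := by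
  have hsub : S ⊆ Set.range (Subtype.val : ({uV f}ᶜ : Set (PVert n)) → PVert n) := by
    rw [Subtype.range_coe, Set.subset_compl_singleton_iff]
    exact hS.1
  rw [← Set.ncard_preimage_of_injective_subset_range Subtype.val_injective hsub]
  refine domNum_le fun x => ?_
  rcases hS.2 x x.2 with h | ⟨w, hw, hadj⟩
  · exact Or.inl h
  · exact Or.inr ⟨⟨w, fun h => hS.1 (h ▸ hw)⟩, hw, hadj⟩

lemma domNumF_le {n : ℕ} {f : ZMod n} {S : Set (PVert n)} (hS : IsDomSetF n f S) :
    domNumF n f ≤ S.ncard :=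
  Nat.sInf_le ⟨S, hS, rfl⟩

lemma domNum_le_domNumF_add_one {n : ℕ} {f : ZMod n} (h : ∃ S, IsDomSetF n f S) :
    domNum (P2 n) ≤ domNumF n f + 1 := by
  obtain ⟨S₀, hS₀⟩ := h
  obtain ⟨S, hS, hc⟩ : ∃ S, MinDomF n f S :=
    Nat.sInf_mem (s := {k | ∃ S : Set (PVert n), IsDomSetF n f S ∧ S.ncard = k}) ⟨_, S₀, hS₀, rfl⟩
  rw [← hc]
  refine (domNum_le fun x => ?_).trans (Set.ncard_insert_le (uV f) S)
  by_cases hx : x = uV f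
  · exact Or.inl (Or.inl hx)
  · rcases hS.2 x hx with h | ⟨w, hw, hadj⟩
    · exact Or.inl (Or.inr h)
    · exact Or.inr ⟨w, Or.inr hw, hadj⟩

/-- for `n ≡ 1` or `2 (mod 5)`, deleting any single vertex
`u_f` from `P(n,2)` decreases the domination number by one, and hence the
domination alteration number of `P(n,2)` equals 1. -/
theorem alteration_one (n : ℕ) (hn : 6 ≤ n) (hmod : n % 5 = 1 ∨ n % 5 = 2) :
    (∀ f : ZMod n, domNumF n f = domNum (P2 n) - 1) ∧ alterNum (P2 n) = 1 := by
  have : NeZero n := ⟨by omega⟩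
  have hlow := three_mul_le_five_mul_domNum n
  constructor
  · intro f
    obtain ⟨S, hS, hc⟩ := exists_isDomSetF_five_mul_ncard_lt hn hmod f
    have h₁ := domNumF_le hS
    have h₂ := domNum_le_domNumF_add_one ⟨S, hS⟩
    omega
  · obtain ⟨S, hS, hc⟩ := exists_isDomSetF_five_mul_ncard_lt hn hmod 0
    have h₁ := domNum_induce_compl_singleton_le hS
    have hmem : 1 ∈ {k | ∃ A : Set (PVert n), A.ncard = k ∧
        domNum ((P2 n).induce Aᶜ) ≠ domNum (P2 n)} :=
      ⟨{uV 0}, Set.ncard_singleton _, by omega⟩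
    refine (Nat.sInf_le hmem).antisymm (le_csInf ⟨1, hmem⟩ ?_)
    rintro k ⟨A, rfl, hA⟩
    rw [Nat.one_le_iff_ne_zero, Ne, Set.ncard_eq_zero]
    rintro rfl
    rw [Set.compl_empty] at hA
    exact hA (domNum_eq_of_iso (SimpleGraph.induceUnivIso _))

end PetersenDom
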